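/- arXiv:2505.00829 — 2 statements merged into one kernel-verified Lean document; each statement's English description precedes it below -/
import Mathlib

section
/- Let C be a finite cyclic group of order n acting on a finite set S, and let m be a divisor of n. Then M_m = Σ_{d ∣ n} gcd(m, d) · a_d, where the sum runs over the divisors d of n. -/
/-- The subgroup `C^m` of `m`-th powers of a (cyclic, hence commutative) group `C`. -/
def powSubgroup (C : Type*) [CommGroup C] (m : ℕ) : Subgroup C :=
  (powMonoidHom m : C →* C).range

/-- `M_m`: the number of orbits of `C^m` on `S`. -/
noncomputable def numPowOrbits (C S : Type*) [CommGroup C] [MulAction C S] (m : ℕ) : ℕ :=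
  Nat.card (MulAction.orbitRel.Quotient (powSubgroup C m) S)

/-- `a_d`: the number of `C`-orbits in `S` of cardinality `d`. -/
noncomputable def numOrbitsOfCard (C S : Type*) [Group C] [MulAction C S] (d : ℕ) : ℕ :=
  Nat.card {ω : MulAction.orbitRel.Quotient C S // Nat.card ω.orbit = d}

/-- The map from `H`-orbits to `G`-orbits, for a subgroup `H` of `G`. -/
def orbitOfSubgroupOrbit {G S : Type*} [Group G] [MulAction G S] (H : Subgroup G) :
    MulAction.orbitRel.Quotient H S → MulAction.orbitRel.Quotient G S :=
  Quotient.map' id fun _ _ h => MulAction.orbitRel_subgroup_le H h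

/-- For an abelian group `G`, the `G`-orbit of `x` splits into `[G : H ⊔ stabilizer x]` many
`H`-orbits. -/
theorem card_fiber_orbitOfSubgroupOrbit {G S : Type*} [CommGroup G] [MulAction G S]
    (H : Subgroup G) (x : S) :
    Nat.card {q // orbitOfSubgroupOrbit H q = (Quotient.mk'' x : MulAction.orbitRel.Quotient G S)} =
      (H ⊔ MulAction.stabilizer G x).index := by
  have key (a b : G) : (Quotient.mk'' (a • x) : MulAction.orbitRel.Quotient H S) =
      Quotient.mk'' (b • x) ↔ a⁻¹ * b ∈ H ⊔ MulAction.stabilizer G x := by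
    rw [Quotient.eq'', MulAction.orbitRel_apply, MulAction.mem_orbit_iff, Subgroup.mem_sup]
    constructor
    · rintro ⟨⟨h, hh⟩, e⟩
      refine ⟨h⁻¹, H.inv_mem hh, h * (a⁻¹ * b), ?_, by group⟩
      rw [MulAction.mem_stabilizer_iff, mul_left_comm, mul_smul, inv_smul_eq_iff, mul_smul]
      exact e
    · rintro ⟨h, hh, k, hk, e⟩
      refine ⟨⟨h⁻¹, H.inv_mem hh⟩, ?_⟩
      rw [eq_inv_mul_iff_mul_eq] at e
      rw [Subgroup.mk_smul, ← e, ← mul_smul, show h⁻¹ * (a * (h * k)) = a * k by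
        rw [mul_left_comm a, inv_mul_cancel_left], mul_smul, MulAction.mem_stabilizer_iff.1 hk]
  symm
  refine Nat.card_congr (Equiv.ofBijective (fun c : G ⧸ (H ⊔ MulAction.stabilizer G x) =>
    Quotient.liftOn' c (fun a => ⟨Quotient.mk'' (a • x),
      Quotient.sound' (MulAction.mem_orbit x a)⟩) fun a b h =>
        Subtype.ext ((key a b).2 (QuotientGroup.leftRel_apply.1 h))) ⟨?_, ?_⟩)
  · rintro ⟨a⟩ ⟨b⟩ h
    exact Quotient.sound' (QuotientGroup.leftRel_apply.2 ((key a b).1 (congrArg Subtype.val h)))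
  · rintro ⟨⟨y⟩, hy⟩
    obtain ⟨a, rfl⟩ := Quotient.exact' hy
    exact ⟨Quotient.mk'' a, rfl⟩

/-- In a finite cyclic group, the `m`-th powers and a subgroup `K` generate a subgroup of index
`gcd(m, [C : K])`. -/
theorem index_powSubgroup_sup {C : Type*} [CommGroup C] [IsCyclic C] [Finite C] (m : ℕ)
    (K : Subgroup C) : (powSubgroup C m ⊔ K).index = Nat.gcd m K.index := by
  have hmap : (powSubgroup C m).map (QuotientGroup.mk' K) =
      (powMonoidHom m : C ⧸ K →* C ⧸ K).range := by
    ext y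
    constructor
    · rintro ⟨_, ⟨c, rfl⟩, rfl⟩
      exact ⟨QuotientGroup.mk' K c, (map_pow (QuotientGroup.mk' K) c m).symm⟩
    · rintro ⟨c, rfl⟩
      obtain ⟨c, rfl⟩ := QuotientGroup.mk'_surjective K c
      exact ⟨_, ⟨c, rfl⟩, map_pow (QuotientGroup.mk' K) c m⟩
  have h := Subgroup.index_map (powSubgroup C m) (QuotientGroup.mk' K)
  have : IsCyclic (C ⧸ K) := isCyclic_of_surjective _ (QuotientGroup.mk'_surjective K)
  rw [hmap, IsCyclic.index_powMonoidHom_range, QuotientGroup.ker_mk', QuotientGroup.range_mk',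
    Subgroup.index_top, mul_one] at h
  rw [← h, Nat.gcd_comm]
  rfl

/-- If a finite cyclic group `C` of order `n` acts on a finite set `S` and
`m ∣ n`, then `M_m = ∑_{d ∣ n} gcd(m, d) · a_d`. -/
theorem numPowOrbits_eq_sum_gcd (C S : Type*) [CommGroup C] [IsCyclic C] [Fintype C]
    [Fintype S] [MulAction C S] (n m : ℕ) (hn : Fintype.card C = n) (hm : m ∣ n) :
    numPowOrbits C S m = ∑ d ∈ n.divisors, Nat.gcd m d * numOrbitsOfCard C S d := by
  classical
  have : Fintype (MulAction.orbitRel.Quotient C S) := Fintype.ofFinite _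
  have hcard (x : S) : (MulAction.stabilizer C x).index =
      Nat.card (MulAction.orbitRel.Quotient.orbit
        (Quotient.mk'' x : MulAction.orbitRel.Quotient C S)) := by
    rw [MulAction.index_stabilizer, MulAction.orbitRel.Quotient.orbit_mk]
    rfl
  have hfiber (ω : MulAction.orbitRel.Quotient C S) :
      Nat.card {q // orbitOfSubgroupOrbit (powSubgroup C m) q = ω} =
        Nat.gcd m (Nat.card ω.orbit) := by
    induction ω using Quotient.inductionOn' with
    | h x => rw [card_fiber_orbitOfSubgroupOrbit, index_powSubgroup_sup, hcard]
  have hdvd (ω : MulAction.orbitRel.Quotient C S) : Nat.card ω.orbit ∈ n.divisors := by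
    induction ω using Quotient.inductionOn' with
    | h x =>
      rw [← hcard, Nat.mem_divisors, ← hn, ← Nat.card_eq_fintype_card]
      exact ⟨Subgroup.index_dvd_card _, Nat.card_pos.ne'⟩
  rw [numPowOrbits, ← Nat.card_congr (Equiv.sigmaFiberEquiv (orbitOfSubgroupOrbit _)),
    Nat.card_sigma, Finset.sum_congr rfl fun ω _ => hfiber ω,
    ← Finset.sum_fiberwise_of_maps_to fun ω _ => hdvd ω]
  refine Finset.sum_congr rfl fun d _ => ?_
  rw [Finset.sum_congr rfl fun ω hω => by rw [(Finset.mem_filter.1 hω).2], Finset.sum_const,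
    smul_eq_mul, mul_comm, numOrbitsOfCard, Nat.card_eq_fintype_card, Fintype.card_subtype]
end

section
/- Let C be a finite cyclic group of order n acting on a finite set S, and let m be a divisor of n. Then a_m = Σ_{d ∣ n/m} μ(d) · N_{m·d}, where μ is the Möbius function and the sum runs over the divisors d of n/m. -/
/-- `Ω`: the number of prime factors counted with multiplicity. -/
def bigOmega (n : ℕ) : ℕ := n.primeFactorsList.length

/-- `rad m`: the radical of `m`, the product of the distinct primes dividing `m`. -/
def rad (m : ℕ) : ℕ := ∏ p ∈ m.primeFactors, p

/-- `N_m = (1/T) · (∑_{T∣d∣m} (−1)^{Ω(m·d)} M_d) / ∏_{q ∣ m/T prime} (q−1)`,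
where `T = m / rad m`. -/
noncomputable def Nfun (C S : Type*) [CommGroup C] [MulAction C S] (m : ℕ) : ℚ :=
  (1 / (m / rad m : ℚ)) *
    (∑ d ∈ m.divisors.filter (m / rad m ∣ ·),
        (-1 : ℚ) ^ bigOmega (m * d) * numPowOrbits C S d) /
      ∏ q ∈ (m / (m / rad m)).primeFactors, ((q : ℚ) - 1)

/-- A sum over orbits of a finite group action, as a weighted sum over points. -/
theorem sum_orbits_eq_sum_div_card_orbit {G X : Type*} [Group G] [Fintype X] [MulAction G X]
    [Fintype (MulAction.orbitRel.Quotient G X)] (f : ℕ → ℚ) :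
    ∑ ω : MulAction.orbitRel.Quotient G X, f (Nat.card ω.orbit) =
      ∑ x : X, f (Nat.card (MulAction.orbit G x)) / Nat.card (MulAction.orbit G x) := by
  classical
  rw [← Finset.sum_fiberwise Finset.univ (fun x ↦ (Quotient.mk'' x : MulAction.orbitRel.Quotient G X))]
  refine Finset.sum_congr rfl fun ω _ ↦ ?_
  have hmem : ∀ x : X, (Quotient.mk'' x : MulAction.orbitRel.Quotient G X) = ω ↔ x ∈ ω.orbit :=
    fun x ↦ MulAction.orbitRel.Quotient.mem_orbit.symm
  have hcard : (Finset.univ.filter fun x : X ↦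
      (Quotient.mk'' x : MulAction.orbitRel.Quotient G X) = ω).card = Nat.card ω.orbit := by
    simp_rw [hmem]
    rw [Nat.card_eq_fintype_card, ← Set.toFinset_card]
    congr 1
    ext x
    simp
  have hpos : (Nat.card ω.orbit : ℚ) ≠ 0 := by
    have := (MulAction.orbitRel.Quotient.nonempty_orbit ω).to_subtype
    exact_mod_cast Nat.card_pos.ne'
  rw [Finset.sum_congr rfl (g := fun _ ↦ f (Nat.card ω.orbit) / Nat.card ω.orbit),
    Finset.sum_const, hcard, nsmul_eq_mul, mul_div_cancel₀ _ hpos]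
  intro x hx
  obtain rfl := (Finset.mem_filter.mp hx).2
  rw [MulAction.orbitRel.Quotient.orbit_mk]

theorem powSubgroup_eq_zpowers {C : Type*} [CommGroup C] {g : C} (hg : ∀ x, x ∈ Subgroup.zpowers g)
    (d : ℕ) : powSubgroup C d = Subgroup.zpowers (g ^ d) := by
  rw [powSubgroup, MonoidHom.range_eq_map, ← (Subgroup.eq_top_iff' _).mpr hg,
    MonoidHom.map_zpowers, powMonoidHom_apply]

/-- In an orbit of size `e` of a cyclic group `C`, the orbits of `C^d` have size `e / gcd(e, d)`. -/
theorem card_orbit_powSubgroup {C S : Type*} [CommGroup C] [IsCyclic C] [Finite S] [MulAction C S]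
    {d : ℕ} (hd : d ≠ 0) (s : S) :
    Nat.card (MulAction.orbit (powSubgroup C d) s) =
      Nat.card (MulAction.orbit C s) / (Nat.card (MulAction.orbit C s)).gcd d := by
  classical
  have := Fintype.ofFinite S
  obtain ⟨g, hg⟩ := IsCyclic.exists_generator (α := C)
  have horb : ∀ x : C, Nat.card (MulAction.orbit (Subgroup.zpowers x) s) =
      Function.minimalPeriod (x • ·) s := fun x ↦ by
    have := Fintype.ofFinite (MulAction.orbit (Subgroup.zpowers x) s)
    rw [MulAction.minimalPeriod_eq_card, Nat.card_eq_fintype_card]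
  have htop : MulAction.orbit C s = MulAction.orbit (Subgroup.zpowers g) s := by
    ext t
    exact ⟨fun ⟨x, hx⟩ ↦ ⟨⟨x, hg x⟩, hx⟩, fun ⟨x, hx⟩ ↦ ⟨x, hx⟩⟩
  rw [powSubgroup_eq_zpowers hg, htop, horb, horb, ← Function.minimalPeriod_iterate_eq_div_gcd hd,
    smul_iterate]

theorem numPowOrbits_eq_sum {C S : Type*} [CommGroup C] [IsCyclic C] [Fintype S] [MulAction C S]
    {d : ℕ} (hd : d ≠ 0) :
    (numPowOrbits C S d : ℚ) =
      ∑ s : S, ((Nat.card (MulAction.orbit C s)).gcd d : ℚ) / Nat.card (MulAction.orbit C s) := by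
  have := Fintype.ofFinite (MulAction.orbitRel.Quotient (powSubgroup C d) S)
  have h := sum_orbits_eq_sum_div_card_orbit (G := powSubgroup C d) (X := S) (fun _ ↦ 1)
  rw [Finset.sum_const, nsmul_one, Finset.card_univ, ← Nat.card_eq_fintype_card] at h
  rw [numPowOrbits, h]
  refine Finset.sum_congr rfl fun s _ ↦ ?_
  rw [card_orbit_powSubgroup hd, Nat.cast_div (Nat.gcd_dvd_left _ _)
    (Nat.cast_ne_zero.mpr (Nat.gcd_ne_zero_right hd)), one_div_div]

theorem numOrbitsOfCard_eq_sum {C S : Type*} [Group C] [Fintype S] [MulAction C S] (m : ℕ) :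
    (numOrbitsOfCard C S m : ℚ) =
      ∑ s : S, (if Nat.card (MulAction.orbit C s) = m then 1 else 0 : ℚ) /
        Nat.card (MulAction.orbit C s) := by
  classical
  have := Fintype.ofFinite (MulAction.orbitRel.Quotient C S)
  rw [← sum_orbits_eq_sum_div_card_orbit (fun e ↦ if e = m then 1 else 0), Finset.sum_boole,
    numOrbitsOfCard, Nat.card_eq_fintype_card, Fintype.card_subtype]

theorem rad_dvd (m : ℕ) : rad m ∣ m := Nat.prod_primeFactors_dvd m

theorem rad_ne_zero (m : ℕ) : rad m ≠ 0 :=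
  Finset.prod_ne_zero_iff.mpr fun _ hp ↦ (Nat.prime_of_mem_primeFactors hp).ne_zero

theorem primeFactors_rad (m : ℕ) : (rad m).primeFactors = m.primeFactors :=
  Nat.primeFactors_prod fun _ ↦ Nat.prime_of_mem_primeFactors

theorem squarefree_rad (m : ℕ) : Squarefree (rad m) := by
  refine Finset.squarefree_prod_of_pairwise_isCoprime (fun p hp q hq hpq ↦ ?_) fun p hp ↦
    (Nat.prime_of_mem_primeFactors hp).prime.squarefree
  exact Nat.coprime_iff_isRelPrime.mp <| (Nat.coprime_primes (Nat.prime_of_mem_primeFactors hp)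
    (Nat.prime_of_mem_primeFactors hq)).mpr hpq

theorem Squarefree.dvd_rad {k m : ℕ} (hk : Squarefree k) (hm : m ≠ 0) (hkm : k ∣ m) :
    k ∣ rad m := by
  rw [← Nat.prod_primeFactors_of_squarefree hk]
  exact Finset.prod_dvd_prod_of_subset _ _ _ (Nat.primeFactors_mono hkm hm)

theorem div_rad_dvd_iff_squarefree {m d : ℕ} (hm : m ≠ 0) (hd : d ∣ m) :
    m / rad m ∣ d ↔ Squarefree (m / d) := by
  obtain ⟨T, hT⟩ := rad_dvd m
  obtain ⟨k, hk⟩ := hd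
  have hr : 0 < rad m := (rad_ne_zero m).pos
  have hd0 : 0 < d := Nat.pos_of_ne_zero fun h ↦ hm (by simp [hk, h])
  have hT0 : 0 < T := Nat.pos_of_ne_zero fun h ↦ hm (by rw [hT, h, mul_zero])
  have hTr : m / rad m = T := Nat.div_eq_of_eq_mul_right hr hT
  have hkd : m / d = k := Nat.div_eq_of_eq_mul_right hd0 hk
  rw [hTr, hkd]
  have key : rad m * T = d * k := hT.symm.trans hk
  constructor
  · rintro ⟨s, rfl⟩
    refine (squarefree_rad m).squarefree_of_dvd ⟨s, Nat.eq_of_mul_eq_mul_right hT0 ?_⟩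
    rw [key]; ring
  · intro h
    obtain ⟨j, hj⟩ := h.dvd_rad hm ⟨d, by rw [hk, mul_comm]⟩
    have hk0 : 0 < k := Nat.pos_of_ne_zero fun h ↦ hm (by simp [hk, h])
    refine ⟨j, Nat.eq_of_mul_eq_mul_right hk0 ?_⟩
    rw [← key, hj]; ring

theorem neg_one_pow_bigOmega_mul {m d : ℕ} (hm : m ≠ 0) (hd : d ∣ m) (h : Squarefree (m / d)) :
    (-1 : ℚ) ^ bigOmega (m * d) = (ArithmeticFunction.moebius (m / d) : ℚ) := by
  obtain ⟨k, rfl⟩ := hd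
  obtain ⟨hd0, hk0⟩ := mul_ne_zero_iff.mp hm
  rw [Nat.mul_div_cancel_left _ hd0.pos] at h ⊢
  have hΩ : bigOmega (d * k * d) = 2 * ArithmeticFunction.cardFactors d +
      ArithmeticFunction.cardFactors k := by
    change ArithmeticFunction.cardFactors (d * k * d) = _
    rw [ArithmeticFunction.cardFactors_mul hm hd0, ArithmeticFunction.cardFactors_mul hd0 hk0]
    ring
  rw [hΩ, pow_add, pow_mul, ArithmeticFunction.moebius_apply_of_squarefree h]
  simp

/-- The Möbius transform of `d ↦ gcd(e, d)` is `m ↦ φ(m)` on the divisors of `e`, and `0` elsewhere. -/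
theorem sum_moebius_mul_gcd {e m : ℕ} (he : e ≠ 0) (hm : m ≠ 0) :
    ∑ d ∈ m.divisors, (ArithmeticFunction.moebius (m / d) : ℚ) * (e.gcd d : ℚ) =
      if m ∣ e then (m.totient : ℚ) else 0 := by
  have h := (ArithmeticFunction.sum_eq_iff_sum_mul_moebius_eq
    (f := fun c ↦ if c ∣ e then (c.totient : ℚ) else 0) (g := fun d ↦ (e.gcd d : ℚ))).mp ?_ m hm.pos
  · rw [← h, Nat.sum_divisorsAntidiagonal'
      (fun a b ↦ (ArithmeticFunction.moebius a : ℚ) * (e.gcd b : ℚ))]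
  · intro d hd
    rw [← Finset.sum_filter, ← Nat.sum_totient (e.gcd d), Nat.cast_sum]
    refine Finset.sum_congr ?_ fun _ _ ↦ rfl
    ext c
    simp [Nat.dvd_gcd_iff, he, hd.ne', and_comm]

theorem totient_eq_div_rad_mul_prod (m : ℕ) :
    (m.totient : ℚ) = (m / rad m : ℚ) * ∏ q ∈ m.primeFactors, ((q : ℚ) - 1) := by
  rw [div_mul_eq_mul_div, eq_div_iff (Nat.cast_ne_zero.mpr (rad_ne_zero m))]
  have h := congrArg (Nat.cast : ℕ → ℚ) (Nat.totient_mul_prod_primeFactors m)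
  rw [Nat.cast_mul, Nat.cast_mul, Nat.cast_prod (fun p ↦ p - 1)] at h
  rw [rad, h]
  congr 1
  exact Finset.prod_congr rfl fun p hp ↦ by
    rw [Nat.cast_pred (Nat.prime_of_mem_primeFactors hp).pos]

/-- `N_m` is the number of `C`-orbits of cardinality divisible by `m`. -/
theorem Nfun_eq_sum {C S : Type*} [CommGroup C] [IsCyclic C] [Fintype S] [MulAction C S]
    {m : ℕ} (hm : m ≠ 0) :
    Nfun C S m = ∑ s : S, (if m ∣ Nat.card (MulAction.orbit C s) then 1 else 0 : ℚ) /
      Nat.card (MulAction.orbit C s) := by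
  have hsum : ∑ d ∈ m.divisors.filter (m / rad m ∣ ·),
      (-1 : ℚ) ^ bigOmega (m * d) * numPowOrbits C S d =
      m.totient * ∑ s : S, (if m ∣ Nat.card (MulAction.orbit C s) then 1 else 0 : ℚ) /
        Nat.card (MulAction.orbit C s) := by
    calc _ = ∑ d ∈ m.divisors, (ArithmeticFunction.moebius (m / d) : ℚ) * numPowOrbits C S d := by
          rw [Finset.sum_filter]
          refine Finset.sum_congr rfl fun d hd ↦ ?_
          have hdm := Nat.dvd_of_mem_divisors hd
          simp_rw [div_rad_dvd_iff_squarefree hm hdm]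
          split_ifs with h
          · rw [neg_one_pow_bigOmega_mul hm hdm h]
          · rw [ArithmeticFunction.moebius_eq_zero_of_not_squarefree h, Int.cast_zero, zero_mul]
      _ = ∑ d ∈ m.divisors, ∑ s : S, (ArithmeticFunction.moebius (m / d) : ℚ) *
            ((Nat.card (MulAction.orbit C s)).gcd d : ℚ) / Nat.card (MulAction.orbit C s) := by
          refine Finset.sum_congr rfl fun d hd ↦ ?_
          rw [numPowOrbits_eq_sum (Nat.pos_of_mem_divisors hd).ne', Finset.mul_sum]
          simp_rw [mul_div_assoc]
      _ = _ := by
          rw [Finset.sum_comm, Finset.mul_sum]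
          refine Finset.sum_congr rfl fun s _ ↦ ?_
          have := (MulAction.nonempty_orbit (M := C) s).to_subtype
          rw [← Finset.sum_div, sum_moebius_mul_gcd Nat.card_pos.ne' hm, ← mul_div_assoc,
            mul_ite, mul_one, mul_zero]
  have hT : m / (m / rad m) = rad m := Nat.div_div_self (rad_dvd m) hm
  have hφ : (m.totient : ℚ) ≠ 0 := Nat.cast_ne_zero.mpr (Nat.totient_pos.mpr hm.pos).ne'
  rw [Nfun, hsum, hT, primeFactors_rad, one_div_mul_eq_div, div_div,
    ← totient_eq_div_rad_mul_prod, mul_div_cancel_left₀ _ hφ]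

theorem sum_moebius_mul_ite_mul_dvd {n m e : ℕ} (hn : n ≠ 0) (hm : m ∣ n) (he : e ∣ n) :
    ∑ d ∈ (n / m).divisors, (ArithmeticFunction.moebius d : ℚ) * (if m * d ∣ e then 1 else 0) =
      if e = m then 1 else 0 := by
  obtain ⟨k, rfl⟩ := hm
  obtain ⟨hm0, hk0⟩ := mul_ne_zero_iff.mp hn
  rw [Nat.mul_div_cancel_left _ hm0.pos]
  by_cases hme : m ∣ e
  · obtain ⟨j, rfl⟩ := hme
    have hjk : j ∣ k := Nat.dvd_of_mul_dvd_mul_left hm0.pos he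
    have hμ := congrArg (fun f ↦ f j) (ArithmeticFunction.coe_zeta_mul_coe_moebius (R := ℚ))
    simp only [ArithmeticFunction.coe_zeta_mul_apply, ArithmeticFunction.intCoe_apply,
      ArithmeticFunction.one_apply] at hμ
    simp_rw [mul_ite, mul_one, mul_zero, Nat.mul_dvd_mul_iff_left hm0.pos]
    rw [← Finset.sum_filter, Nat.divisors_filter_dvd_of_dvd hk0 hjk, hμ]
    simp [hm0]
  · rw [if_neg fun h : e = m ↦ hme h.symm.dvd]
    refine Finset.sum_eq_zero fun d _ ↦ ?_
    rw [if_neg fun h ↦ hme (dvd_of_mul_right_dvd h), mul_zero]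

/-- Theorem `formula`: if a finite cyclic group `C` of order `n` acts on a
finite set `S` and `m ∣ n`, then `a_m = ∑_{d ∣ n/m} μ(d) · N_{m·d}`. -/
theorem numOrbitsOfCard_eq_moebius_sum (C S : Type*) [CommGroup C] [IsCyclic C] [Fintype C]
    [Fintype S] [MulAction C S] (n m : ℕ) (hn : Fintype.card C = n) (hm : m ∣ n) :
    (numOrbitsOfCard C S m : ℚ) =
      ∑ d ∈ (n / m).divisors, (ArithmeticFunction.moebius d : ℚ) * Nfun C S (m * d) := by
  have hn0 : n ≠ 0 := hn ▸ Fintype.card_ne_zero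
  have hm0 : m ≠ 0 := ne_zero_of_dvd_ne_zero hn0 hm
  have hcard : ∀ s : S, Nat.card (MulAction.orbit C s) ∣ n := fun s ↦ by
    rw [← hn, ← Nat.card_eq_fintype_card, Nat.card_congr (MulAction.orbitEquivQuotientStabilizer C s)]
    exact Subgroup.card_quotient_dvd_card _
  calc _ = ∑ s : S, (∑ d ∈ (n / m).divisors, (ArithmeticFunction.moebius d : ℚ) *
          (if m * d ∣ Nat.card (MulAction.orbit C s) then 1 else 0)) /
            Nat.card (MulAction.orbit C s) := by
        simp_rw [numOrbitsOfCard_eq_sum, sum_moebius_mul_ite_mul_dvd hn0 hm (hcard _)]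
    _ = _ := by
        simp_rw [Finset.sum_div]
        rw [Finset.sum_comm]
        refine Finset.sum_congr rfl fun d hd ↦ ?_
        rw [Nfun_eq_sum (mul_ne_zero hm0 (Nat.pos_of_mem_divisors hd).ne'), Finset.mul_sum]
        simp_rw [mul_div_assoc]
end
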